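/- arXiv:2111.09080 — 2 statements merged into one kernel-verified Lean document; each statement's English description precedes it below -/
import Mathlib

section
/- Let k be a perfect field whose separable closure k^sep is a finite extension of k. Then either k is algebraically closed, or k is a real closed field (i.e., char(k) = 0, k is not algebraically closed, and k[√−1] is algebraically closed). -/
/-- `k` is a real closed field: it has characteristic zero, is not algebraically closed, and
adjoining a square root of `-1` to `k` yields an algebraically closed field. -/
def IsRealClosedField (k : Type) [Field k] : Prop :=
  CharZero k ∧ ¬ IsAlgClosed k ∧
    ∀ (K : Type) [Field K] [Algebra k K] (i : K), i ^ 2 = -1 →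
      Algebra.adjoin k {i} = ⊤ → IsAlgClosed K

open Module Polynomial IntermediateField

/-- An algebraically closed field of characteristic `p` is not Galois of degree `p` over a
subfield. -/
theorem finrank_ne_of_charP {F C : Type*} [Field F] [Field C] [Algebra F C]
    [FiniteDimensional F C] [IsGalois F C] [IsAlgClosed C] (p : ℕ) [Fact p.Prime] [CharP F p] :
    finrank F C ≠ p := by
  intro h
  have : CharP C p := charP_of_injective_algebraMap (algebraMap F C).injective p
  have hp : p.Prime := Fact.out
  -- `x ↦ x ^ p - x` is surjective on `F`
  have hsurj (b : F) : ∃ x : F, x ^ p - x = b := by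
    obtain ⟨c, rfl⟩ := Algebra.trace_surjective F C b
    obtain ⟨d, hd⟩ := IsAlgClosed.exists_root (X ^ p - X - Polynomial.C c) (by
      rw [sub_sub]
      have : (X + Polynomial.C c).degree < (X ^ p : C[X]).degree := by
        rw [degree_X_add_C, degree_X_pow]; exact_mod_cast hp.one_lt
      rw [degree_sub_eq_left_of_degree_lt this, degree_X_pow]
      exact_mod_cast hp.ne_zero)
    have hd' : d ^ p - d = c := by simpa [IsRoot, sub_eq_zero] using hd
    refine ⟨Algebra.trace F C d, (algebraMap F C).injective ?_⟩
    simp only [map_sub, map_pow, trace_eq_sum_automorphisms, ← hd', sum_pow_char p]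
  have hcard : Nat.card (C ≃ₐ[F] C) = p := (IsGalois.card_aut_eq_finrank F C).trans h
  obtain ⟨σ, hσ⟩ := isCyclic_of_prime_card hcard |>.exists_generator
  have hσp : σ ^ p = 1 := by rw [← hcard]; exact pow_card_eq_one'
  obtain ⟨a, ha⟩ : ∃ a, σ a = a + 1 := by
    let s : Module.End F C := σ.toLinearMap
    have hs (n : ℕ) (x : C) : (s ^ n) x = (σ ^ n) x := by
      induction n generalizing x with
      | zero => simp
      | succ n ih => rw [pow_succ, pow_succ, Module.End.mul_apply, ih]; rfl
    have hnil : (s - 1) ^ p = 0 := by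
      have : CharP (Module.End F C) p := charP_of_injective_algebraMap (algebraMap F _).injective p
      rw [sub_pow_char_of_commute p (Commute.one_right s)]
      ext x
      simp [hs, hσp]
    have hne : s - 1 ≠ 0 := by
      intro h0
      have h1 : σ = 1 := by
        ext x
        simpa [s, sub_eq_zero] using congrArg (· x) h0
      have : Nat.card (C ≃ₐ[F] C) = 1 := by
        rw [Nat.card_eq_one_iff_unique]
        refine ⟨⟨fun x y ↦ ?_⟩, ⟨1⟩⟩
        have hx := hσ x
        have hy := hσ y
        simp only [h1, Subgroup.zpowers_one_eq_bot, Subgroup.mem_bot] at hx hy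
        rw [hx, hy]
      exact hp.ne_one (hcard.symm.trans this)
    have hex : ∃ n, (s - 1) ^ n = 0 := ⟨p, hnil⟩
    classical
    obtain ⟨m, hm⟩ : ∃ m, Nat.find hex = m + 2 := by
      refine ⟨Nat.find hex - 2, ?_⟩
      have h0 := Nat.find_spec hex
      rcases h : Nat.find hex with _ | _ | n
      · rw [h] at h0; simp at h0
      · rw [h] at h0; simp at h0; exact absurd h0 hne
      · rfl
    have h1 : (s - 1) ^ (m + 1) ≠ 0 := Nat.find_min hex (by omega)
    have h2 : (s - 1) ^ (m + 2) = 0 := hm ▸ Nat.find_spec hex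
    obtain ⟨x, hx⟩ : ∃ x, ((s - 1) ^ (m + 1)) x ≠ 0 := by
      by_contra! hall
      exact h1 (LinearMap.ext hall)
    set z := ((s - 1) ^ m) x with hz
    have hy : ((s - 1) ^ (m + 1)) x = σ z - z := by rw [pow_succ']; rfl
    have hy2 : σ (σ z - z) - (σ z - z) = 0 := by
      have := LinearMap.congr_fun h2 x
      rw [pow_succ', Module.End.mul_apply, hy] at this
      exact this
    rw [hy] at hx
    refine ⟨z / (σ z - z), ?_⟩
    rw [map_div₀, sub_eq_zero.mp hy2]
    field_simp
    ring
  obtain ⟨b, hb⟩ : ∃ b : F, algebraMap F C b = a ^ p - a := by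
    refine (IsGalois.mem_range_algebraMap_iff_fixed (F := F) (E := C) (a ^ p - a)).2 fun τ ↦ ?_
    have : ∀ τ ∈ Subgroup.zpowers σ, τ (a ^ p - a) = a ^ p - a := by
      change Subgroup.zpowers σ ≤ MulAction.stabilizer _ (a ^ p - a)
      rw [Subgroup.zpowers_le]
      change σ _ = _
      rw [map_sub, map_pow, ha, add_pow_char]
      ring
    exact this τ (hσ τ)
  obtain ⟨c, rfl⟩ := hsurj b
  have hroot : (a - algebraMap F C c) ^ p = a - algebraMap F C c := by
    rw [sub_pow_char]
    simp only [map_sub, map_pow] at hb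
    linear_combination -hb
  have hfix : a - algebraMap F C c ∈ RingHom.eqLocusField (σ : C →+* C) (RingHom.id C) :=
    (bot_le : ⊥ ≤ RingHom.eqLocusField (σ : C →+* C) (RingHom.id C))
      ((Subfield.mem_bot_iff_pow_eq_self C p).2 hroot)
  have hfix' : σ (a - algebraMap F C c) = a - algebraMap F C c := hfix
  simp [ha] at hfix'

/-- An algebraically closed field of characteristic other than `p` is not Galois of degree `p` over
a subfield containing a square root of `-1`. -/
theorem finrank_ne_of_natCast_ne_zero {F C : Type*} [Field F] [Field C] [Algebra F C]
    [FiniteDimensional F C] [IsGalois F C] [IsAlgClosed C] (p : ℕ) [Fact p.Prime]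
    (hpF : (p : F) ≠ 0) (i : F) (hi : i ^ 2 = -1) : finrank F C ≠ p := by
  intro h
  have hp : p.Prime := Fact.out
  have : NeZero (p : C) := ⟨by
    rw [← map_natCast (algebraMap F C)]
    exact (_root_.map_ne_zero _).2 hpF⟩
  obtain ⟨ζ, hζ⟩ := HasEnoughRootsOfUnity.exists_primitiveRoot C p
  -- the degree of `ζ` divides `p` and is less than `p`
  obtain ⟨ζ', rfl⟩ : ∃ ζ' : F, algebraMap F C ζ' = ζ := by
    have hint : IsIntegral F ζ := Algebra.IsIntegral.isIntegral ζ
    have hdvd : (minpoly F ζ).natDegree ∣ p := h ▸ minpoly.degree_dvd hint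
    have hle : (minpoly F ζ).natDegree ≤ p - 1 := by
      rw [← Nat.totient_prime hp, ← natDegree_cyclotomic p F]
      refine natDegree_le_of_dvd (minpoly.dvd F ζ ?_) (cyclotomic_ne_zero p F)
      rw [aeval_def, eval₂_eq_eval_map, map_cyclotomic]
      exact hζ.isRoot_cyclotomic hp.pos
    have h1 : (minpoly F ζ).natDegree = 1 := by
      rcases (Nat.dvd_prime hp).1 hdvd with h1 | h1
      · exact h1
      · have := hp.pos
        omega
    exact minpoly.mem_range_of_degree_eq_one F ζ (by
      rw [degree_eq_natDegree (minpoly.ne_zero hint), h1]; rfl)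
  have hζ' : IsPrimitiveRoot ζ' p := hζ.of_map_of_injective (algebraMap F C).injective
  have : IsCyclic (C ≃ₐ[F] C) := isCyclic_of_prime_card ((IsGalois.card_aut_eq_finrank F C).trans h)
  obtain ⟨a, hirr, -⟩ := ((isCyclic_tfae F C
    ⟨ζ', by rw [h]; exact (mem_primitiveRoots hp.pos).2 hζ'⟩).out 0 1).1
      (And.intro ‹IsGalois F C› ‹IsCyclic (C ≃ₐ[F] C)›)
  rw [h] at hirr
  obtain ⟨α, hα⟩ := IsAlgClosed.exists_pow_nat_eq (algebraMap F C a) hp.pos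
  obtain ⟨β, hβ⟩ := IsAlgClosed.exists_pow_nat_eq α hp.pos
  have hmin : minpoly F α = X ^ p - Polynomial.C a :=
    (minpoly.eq_of_irreducible_of_monic hirr (by simp [hα])
      (monic_X_pow_sub_C a hp.ne_zero)).symm
  have hint : IsIntegral F α := Algebra.IsIntegral.isIntegral α
  have hdeg : finrank F F⟮α⟯ = p := by
    rw [adjoin.finrank hint, hmin, natDegree_X_pow_sub_C]
  have hone : finrank F⟮α⟯ C = 1 := by
    have := finrank_mul_finrank F F⟮α⟯ C
    rw [hdeg, h] at this
    exact Nat.eq_of_mul_eq_mul_left hp.pos (this.trans (mul_one p).symm)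
  have hnorm : Algebra.norm F α = (-1) ^ (p + 1) * a := by
    rw [Algebra.norm_eq_norm_adjoin, hone, pow_one, ← adjoin.powerBasis_gen hint,
      Algebra.PowerBasis.norm_gen_eq_coeff_zero_minpoly, adjoin.powerBasis_gen, minpoly_gen, hmin,
      adjoin.powerBasis_dim, hmin, natDegree_X_pow_sub_C]
    simp [hp.ne_zero.symm, pow_succ]
  have hno (b : F) : b ^ p ≠ a := pow_ne_of_irreducible_X_pow_sub_C hirr dvd_rfl hp.ne_one b
  have hN : Algebra.norm F β ^ p = (-1) ^ (p + 1) * a := by rw [← map_pow, hβ, hnorm]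
  rcases hp.eq_two_or_odd' with rfl | hodd
  · refine hno (i * Algebra.norm F β) ?_
    rw [mul_pow, hN, hi]
    ring
  · refine hno (Algebra.norm F β) ?_
    rw [hN, hodd.add_one.neg_one_pow, one_mul]

theorem adjoin_eq_top_of_sq_eq_neg_one {k C : Type*} [Field k] [Field C] [Algebra k C]
    [FiniteDimensional k C] [IsGalois k C] [IsAlgClosed C] (i : C) (hi : i ^ 2 = -1) :
    k⟮i⟯ = ⊤ := by
  by_contra hne
  have h1 : Nat.card (C ≃ₐ[k⟮i⟯] C) ≠ 1 := by
    rw [IsGalois.card_aut_eq_finrank]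
    exact fun h ↦ hne (IntermediateField.finrank_eq_one_iff_eq_top.1 h)
  obtain ⟨p, hp, hdvd⟩ := Nat.exists_prime_and_dvd h1
  have : Fact p.Prime := ⟨hp⟩
  obtain ⟨σ, hσ⟩ := exists_prime_orderOf_dvd_card' p hdvd
  let F := fixedField (Subgroup.zpowers σ)
  have hF : finrank F C = p := by
    rw [finrank_fixedField_eq_card, Nat.card_zpowers, hσ]
  by_cases hpF : (p : F) = 0
  · have : CharP F p := (CharP.charP_iff_prime_eq_zero hp).2 hpF
    exact finrank_ne_of_charP p hF
  · refine finrank_ne_of_natCast_ne_zero p hpF (algebraMap k⟮i⟯ F (AdjoinSimple.gen k i)) ?_ hF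
    apply (algebraMap F C).injective
    simp only [map_pow, map_neg, map_one, ← IsScalarTower.algebraMap_apply]
    simpa using hi

/-- Every element of `k[i]` has the form `c + d i`. -/
theorem exists_eq_add_mul_of_mem_adjoin {k A : Type*} [Field k] [CommRing A] [Algebra k A] {i : A}
    (hi : i ^ 2 = -1) {z : A} (hz : z ∈ Algebra.adjoin k {i}) :
    ∃ c d : k, z = algebraMap k A c + algebraMap k A d * i := by
  induction hz using Algebra.adjoin_induction with
  | mem x hx => exact ⟨0, 1, by simpa using hx⟩
  | algebraMap r => exact ⟨r, 0, by simp⟩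
  | add x y _ _ hx hy =>
    obtain ⟨c, d, rfl⟩ := hx
    obtain ⟨c', d', rfl⟩ := hy
    exact ⟨c + c', d + d', by simp only [map_add]; ring⟩
  | mul x y _ _ hx hy =>
    obtain ⟨c, d, rfl⟩ := hx
    obtain ⟨c', d', rfl⟩ := hy
    refine ⟨c * c' - d * d', c * d' + d * c', ?_⟩
    simp only [map_add, map_sub, map_mul]
    linear_combination algebraMap k A d * algebraMap k A d' * hi

theorem charZero_of_adjoin_eq_top {k C : Type*} [Field k] [Field C] [Algebra k C] [IsAlgClosed C]
    {i : C} (hi : i ^ 2 = -1) (htop : Algebra.adjoin k {i} = ⊤)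
    (hno : ∀ j : k, j ^ 2 ≠ -1) : CharZero k := by
  obtain ⟨p, hp⟩ := CharP.exists k
  rcases CharP.char_is_prime_or_zero k p with hprime | rfl
  · have : NeZero p := ⟨hprime.ne_zero⟩
    obtain ⟨a', b', hab⟩ := CharP.sq_add_sq k p (-1)
    obtain ⟨a, b, hab⟩ : ∃ a b : k, a ^ 2 + b ^ 2 = -1 := ⟨a', b', by simpa using hab⟩
    obtain ⟨z, hz⟩ := IsAlgClosed.exists_pow_nat_eq (algebraMap k C a + algebraMap k C b * i)
      two_pos
    obtain ⟨c, d, rfl⟩ := exists_eq_add_mul_of_mem_adjoin hi (htop ▸ Algebra.mem_top : z ∈ _)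
    have hlin {x y : k} (hxy : algebraMap k C x + algebraMap k C y * i = 0) : x = 0 ∧ y = 0 := by
      have hy : y = 0 := by
        by_contra hy
        refine hno (x / y) ((algebraMap k C).injective ?_)
        have hy' : algebraMap k C y ≠ 0 := by simpa using hy
        have : algebraMap k C x = -(algebraMap k C y * i) := eq_neg_of_add_eq_zero_left hxy
        simp only [map_pow, map_div₀, map_neg, map_one, this]
        field_simp
        exact hi
      subst hy
      simpa using hxy
    obtain ⟨h1, h2⟩ := hlin (x := c ^ 2 - d ^ 2 - a) (y := 2 * c * d - b) (by
      simp only [map_sub, map_pow, map_mul, map_ofNat]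
      linear_combination hz - algebraMap k C d ^ 2 * hi)
    refine absurd ?_ (hno (c ^ 2 + d ^ 2))
    rw [← hab, ← sub_eq_zero.1 h1, ← sub_eq_zero.1 h2]
    ring
  · exact CharP.charP_to_charZero k

universe u

theorem isAlgClosed_of_adjoin_eq_top {k : Type*} {C : Type u} [Field k] [Field C] [Algebra k C]
    [IsAlgClosed C] {i : C} (hi : i ^ 2 = -1) (htop : Algebra.adjoin k {i} = ⊤)
    {K : Type u} [Field K] [Algebra k K] {j : K} (hj : j ^ 2 = -1)
    (hjtop : Algebra.adjoin k {j} = ⊤) : IsAlgClosed K := by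
  have hint : IsIntegral k j := ⟨X ^ 2 + 1, by monicity!, by simp [hj]⟩
  have : Algebra.IsAlgebraic k K := by
    have := Algebra.IsIntegral.adjoin (R := k) (S := {j}) (by simpa using hint)
    rw [hjtop] at this
    exact (Algebra.isIntegral_def.2 fun x ↦
      (isIntegral_algHom_iff (⊤ : Subalgebra k K).val Subtype.val_injective).2
        (this.isIntegral ⟨x, trivial⟩)).isAlgebraic
  let f : K →ₐ[k] C := IsAlgClosed.lift
  have hf : Function.Surjective f := by
    rw [← AlgHom.range_eq_top, eq_top_iff, ← htop, Algebra.adjoin_le_iff, Set.singleton_subset_iff]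
    have : (f j) ^ 2 = i ^ 2 := by rw [← map_pow, hj, hi, map_neg, map_one]
    rcases sq_eq_sq_iff_eq_or_eq_neg.1 this with h | h
    · exact ⟨j, h⟩
    · exact ⟨-j, by simp [h]⟩
  exact IsAlgClosed.of_ringEquiv C K (RingEquiv.ofBijective f ⟨f.injective, hf⟩).symm

/-- Artin–Schreier: a perfect field whose separable closure is a finite extension is either
algebraically closed or real closed. -/
theorem stmt_6 (k : Type) [Field k] [PerfectField k]
    (h : FiniteDimensional k (separableClosure k (AlgebraicClosure k))) :
    IsAlgClosed k ∨ IsRealClosedField k := by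
  have : IsGalois k (AlgebraicClosure k) := {}
  have : FiniteDimensional k (AlgebraicClosure k) := by
    rw [(separableClosure.eq_top_iff k (AlgebraicClosure k)).2 inferInstance] at h
    exact topEquiv.toLinearEquiv.finiteDimensional
  obtain ⟨i, hi⟩ := IsAlgClosed.exists_pow_nat_eq (-1 : AlgebraicClosure k) two_pos
  have htop : Algebra.adjoin k {i} = ⊤ := by
    rw [← adjoin_simple_toSubalgebra_of_isAlgebraic (Algebra.IsAlgebraic.isAlgebraic i),
      adjoin_eq_top_of_sq_eq_neg_one i hi, top_toSubalgebra]
  by_cases hk : IsAlgClosed k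
  · exact .inl hk
  refine .inr ⟨charZero_of_adjoin_eq_top hi htop fun j hj ↦ hk ?_, hk,
    fun K _ _ j hj hjtop ↦ isAlgClosed_of_adjoin_eq_top hi htop hj hjtop⟩
  refine isAlgClosed_of_adjoin_eq_top hi htop hj ?_
  rw [eq_top_iff]
  exact fun x _ ↦ Subalgebra.algebraMap_mem _ x
end

section
/- Let k be a real closed field. Then up to conjugation by invertible elements of the target, for every finite-dimensional division algebra A over k and every finite-dimensional simple k-algebra B, there are only finitely many k-algebra homomorphisms A → B. -/
open scoped TensorProduct

/-- A normalised separability idempotent: a finite-dimensional division algebra over a field of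
characteristic zero is a separable algebra. -/
theorem exists_separability_idempotent (k A : Type*) [Field k] [CharZero k] [DivisionRing A]
    [Algebra k A] [FiniteDimensional k A] :
    ∃ (n : ℕ) (a b : Fin n → A), ∑ i, a i * b i = 1 ∧
      ∀ x : A, ∑ i, (x * a i) ⊗ₜ[k] b i = ∑ i, a i ⊗ₜ[k] (b i * x) := by
  classical
  let T : A →ₗ[k] k := LinearMap.trace k A ∘ₗ (LinearMap.mul k A)
  have T_comm (x y : A) : T (x * y) = T (y * x) := by
    have hmul (x y : A) : LinearMap.mul k A (x * y) =
        LinearMap.mul k A x * LinearMap.mul k A y := by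
      ext; simp [mul_assoc]
    simp only [T, LinearMap.comp_apply, hmul]
    exact LinearMap.trace_mul_comm k _ _
  have T_one : T 1 = Module.finrank k A := by
    have : LinearMap.mul k A 1 = LinearMap.id := by ext; simp
    simp [T, this]
  have finrank_ne : (Module.finrank k A : k) ≠ 0 :=
    Nat.cast_ne_zero.mpr Module.finrank_pos.ne'
  let F : LinearMap.BilinForm k A := (LinearMap.mul k A).compr₂ T
  have hF (x y : A) : F x y = T (x * y) := rfl
  have F_symm : F.IsSymm := ⟨fun x y => T_comm x y⟩
  have F_nondeg : F.Nondegenerate := by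
    refine (F_symm.isRefl.nondegenerate_iff_separatingLeft).mpr ?_
    intro x hx
    by_contra h
    have := hx x⁻¹
    rw [hF, mul_inv_cancel₀ h, T_one] at this
    exact finrank_ne this
  let v := Module.finBasis k A
  let d := F.dualBasis F_nondeg v
  have expand_d (x : A) : ∑ i, F x (v i) • d i = x := by
    conv_rhs => rw [← d.sum_repr x]
    simp [d, LinearMap.BilinForm.dualBasis_repr_apply]
  have expand_v (x : A) : ∑ i, F x (d i) • v i = x := by
    have h := LinearMap.BilinForm.dualBasis_dualBasis F_nondeg F_symm v
    conv_rhs => rw [← v.sum_repr x]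
    refine Finset.sum_congr rfl fun i _ => ?_
    rw [← LinearMap.BilinForm.dualBasis_repr_apply F_nondeg d, h]
  have casimir (x : A) : ∑ i, (x * v i) ⊗ₜ[k] d i = ∑ i, v i ⊗ₜ[k] (d i * x) := by
    have hl (i) : (x * v i) ⊗ₜ[k] d i = ∑ j, F (x * v i) (d j) • (v j ⊗ₜ[k] d i) := by
      conv_lhs => rw [← expand_v (x * v i)]
      simp only [TensorProduct.sum_tmul, TensorProduct.smul_tmul']
    have hr (j) : v j ⊗ₜ[k] (d j * x) = ∑ i, F (d j * x) (v i) • (v j ⊗ₜ[k] d i) := by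
      conv_lhs => rw [← expand_d (d j * x)]
      simp only [TensorProduct.tmul_sum, TensorProduct.tmul_smul]
    simp only [hl, hr]
    rw [Finset.sum_comm]
    refine Finset.sum_congr rfl fun i _ => Finset.sum_congr rfl fun j _ => ?_
    rw [hF, hF, T_comm, mul_assoc]
  let c : A := ∑ i, v i * d i
  have c_comm (x : A) : x * c = c * x := by
    have := congrArg (LinearMap.mul' k A) (casimir x)
    simpa [c, Finset.mul_sum, Finset.sum_mul, mul_assoc] using this
  have c_ne : c ≠ 0 := by
    intro h
    have hT : T c = Module.finrank k A := by
      simp only [c, map_sum, ← hF]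
      simp [d, LinearMap.BilinForm.apply_dualBasis_right F_nondeg F_symm]
    rw [h, map_zero] at hT
    exact finrank_ne hT.symm
  refine ⟨_, v, fun i => d i * c⁻¹, ?_, fun x => ?_⟩
  · simp only [← mul_assoc, ← Finset.sum_mul]
    exact mul_inv_cancel₀ c_ne
  · have := congrArg (LinearMap.lTensor A (LinearMap.mulRight k c⁻¹)) (casimir x)
    have hc : c⁻¹ * x = x * c⁻¹ := (Commute.inv_right₀ (c_comm x)).symm
    simpa [mul_assoc, hc] using this

/-- The tensor product of a finite-dimensional division algebra with a semisimple algebra over a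
field of characteristic zero is semisimple. -/
theorem isSemisimpleRing_tensorProduct (k A S : Type*) [Field k] [CharZero k] [DivisionRing A]
    [Algebra k A] [FiniteDimensional k A] [Ring S] [Algebra k S] [IsSemisimpleRing S] :
    IsSemisimpleRing (A ⊗[k] S) := by
  obtain ⟨n, a, b, hab, hcas⟩ := exists_separability_idempotent k A
  let ιA : A →ₐ[k] A ⊗[k] S := Algebra.TensorProduct.includeLeft
  let ιS : S →ₐ[k] A ⊗[k] S := Algebra.TensorProduct.includeRight
  have hcomm (x : A) (y : S) : ιA x * ιS y = ιS y * ιA x := by simp [ιA, ιS]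
  have htmul (x : A) (y : S) : x ⊗ₜ[k] y = ιA x * ιS y := by simp [ιA, ιS]
  let _ : Module S (A ⊗[k] S) := Module.compHom _ ιS.toRingHom
  refine (isSemisimpleModule_iff _ _).mpr ⟨fun N => ?_⟩
  let N' : Submodule S (A ⊗[k] S) :=
    { N.toAddSubmonoid with smul_mem' := fun y m hm => N.smul_mem (ιS y) hm }
  obtain ⟨K, hK⟩ := exists_isCompl N'
  let p : A ⊗[k] S →ₗ[S] A ⊗[k] S := N'.subtype ∘ₗ Submodule.projectionOnto N' K hK
  have p_mem (m) : p m ∈ N := (Submodule.projectionOnto N' K hK m).2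
  have p_id (m) (hm : m ∈ N) : p m = m :=
    congrArg Subtype.val (Submodule.projectionOnto_apply_left hK ⟨m, hm⟩)
  have p_S (y : S) (m) : p (ιS y * m) = ιS y * p m := p.map_smul y m
  have p_k (r : k) (m) : p (r • m) = r • p m := by
    have := p_S (algebraMap k S r) m
    simpa [Algebra.smul_def] using this
  let L (m : A ⊗[k] S) : A ⊗[k] A →ₗ[k] A ⊗[k] S := TensorProduct.lift
    (LinearMap.mk₂ k (fun x y => ιA x * p (ιA y * m))
      (by intros; simp only [map_add, add_mul])
      (by intros; simp only [map_smul, smul_mul_assoc])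
      (by intros; simp only [map_add, add_mul, mul_add])
      (by intros; simp only [map_smul, smul_mul_assoc, p_k, mul_smul_comm]))
  have hL (m x y) : L m (x ⊗ₜ y) = ιA x * p (ιA y * m) := rfl
  let q (m : A ⊗[k] S) : A ⊗[k] S := ∑ i, ιA (a i) * p (ιA (b i) * m)
  have q_A (x : A) (m) : q (ιA x * m) = ιA x * q m := by
    have := congrArg (L m) (hcas x)
    simp only [map_sum, hL, map_mul, mul_assoc] at this
    simp only [q, Finset.mul_sum, this]
  have q_S (y : S) (m) : q (ιS y * m) = ιS y * q m := by
    simp only [q, Finset.mul_sum]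
    refine Finset.sum_congr rfl fun i _ => ?_
    rw [← mul_assoc, hcomm, mul_assoc, p_S, ← mul_assoc, hcomm, mul_assoc]
  have q_add (m m') : q (m + m') = q m + q m' := by
    simp only [q, mul_add, map_add, Finset.sum_add_distrib]
  have q_mul (r m) : q (r * m) = r * q m := by
    induction r with
    | zero => simp [q]
    | tmul x y => rw [htmul, mul_assoc, q_A, q_S, mul_assoc]
    | add r r' h h' => rw [add_mul, q_add, h, h', add_mul]
  have q_mem (m) : q m ∈ N := N.sum_mem fun i _ => N.smul_mem _ (p_mem _)
  have q_id (m) (hm : m ∈ N) : q m = m := by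
    have key (i) : ιA (a i) * p (ιA (b i) * m) = ιA (a i * b i) * m := by
      rw [p_id (ιA (b i) * m) (N.smul_mem _ hm), map_mul, mul_assoc]
    simp only [q, key, ← Finset.sum_mul, ← map_sum, hab, map_one, one_mul]
  let Q : A ⊗[k] S →ₗ[A ⊗[k] S] N :=
    { toFun := fun m => ⟨q m, q_mem m⟩
      map_add' := fun m m' => Subtype.ext (q_add m m')
      map_smul' := fun r m => Subtype.ext (q_mul r m) }
  exact ⟨LinearMap.ker Q, LinearMap.isCompl_of_proj fun x => Subtype.ext (q_id x x.2)⟩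

/-- Over a semisimple ring there are finitely many simple modules up to isomorphism. -/
theorem IsSemisimpleRing.exists_fin_simple_representatives (R : Type*) [Ring R]
    [IsSemisimpleRing R] :
    ∃ (n : ℕ) (S : Fin n → Ideal R), (∀ i, IsSimpleModule R (S i)) ∧
      ∀ (M : Type*) [AddCommGroup M] [Module R M] [IsSimpleModule R M],
        ∃ i, Nonempty (M ≃ₗ[R] S i) := by
  classical
  obtain ⟨n, S, e, hS⟩ := IsSemisimpleModule.exists_linearEquiv_fin_dfinsupp R R
  refine ⟨n, S, hS, fun M _ _ _ => ?_⟩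
  have := IsSimpleModule.nontrivial R M
  obtain ⟨m, hm⟩ := exists_ne (0 : M)
  let g : (Π₀ i : Fin n, S i) →ₗ[R] M := LinearMap.toSpanSingleton R M m ∘ₗ e.symm.toLinearMap
  have hg : g ≠ 0 := by
    intro h
    apply hm
    simpa [g] using LinearMap.congr_fun h (e 1)
  obtain ⟨i, hi⟩ : ∃ i, g ∘ₗ DFinsupp.lsingle i ≠ 0 := by
    by_contra! h
    exact hg (DFinsupp.lhom_ext' fun i => by rw [h i, LinearMap.zero_comp])
  exact ⟨i, ⟨(LinearEquiv.ofBijective _ (LinearMap.bijective_of_ne_zero hi)).symm⟩⟩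

/-- Over a semisimple ring there are finitely many modules of bounded length up to isomorphism. -/
theorem IsSemisimpleRing.exists_classifier_of_length_le (R : Type*) [Ring R]
    [IsSemisimpleRing R] (N : ℕ) {T : Type*} (M : T → Type*) [∀ t, AddCommGroup (M t)]
    [∀ t, Module R (M t)] (hM : ∀ t, Module.length R (M t) ≤ N) :
    ∃ (ι : Type) (_ : Finite ι) (c : T → ι),
      ∀ s t, c s = c t → Nonempty (M s ≃ₗ[R] M t) := by
  classical
  obtain ⟨n, S, hS, hrep⟩ := IsSemisimpleRing.exists_fin_simple_representatives R
  have key (t) : ∃ (x : Σ m : Fin (N + 1), Fin m → Fin n),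
      Nonempty (M t ≃ₗ[R] ∀ i, S (x.2 i)) := by
    have hfin : IsFiniteLength R (M t) :=
      Module.length_ne_top_iff.mp ((hM t).trans_lt (ENat.natCast_lt_top N)).ne
    have := (isFiniteLength_iff_isNoetherian_isArtinian.mp hfin).1
    obtain ⟨m, P, e, hP⟩ := IsSemisimpleModule.exists_linearEquiv_fin_dfinsupp R (M t)
    choose σ hσ using fun i => hrep (P i)
    let e' : M t ≃ₗ[R] ∀ i, S (σ i) := e.trans <| (DFinsupp.linearEquivFunOnFintype).trans <|
      LinearEquiv.piCongrRight fun i => (hσ i).some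
    have hm : m ≤ N := by
      have := hM t
      rw [e'.length_eq, Module.length_pi_of_fintype] at this
      simpa using this
    exact ⟨⟨⟨m, Nat.lt_succ_of_le hm⟩, σ⟩, ⟨e'⟩⟩
  choose c hc using key
  refine ⟨_, inferInstance, c, fun s t h => ?_⟩
  have ht := hc t
  rw [← h] at ht
  exact ⟨(hc s).some.trans ht.some.symm⟩

section Bimodule

variable {k A B : Type*} [Field k] [Ring A] [Algebra k A] [Ring B] [Algebra k B]

/-- The ring homomorphism sending `x ⊗ op y` to the map `b ↦ f x * b * y`. -/
noncomputable def AlgHom.bimoduleAction (f : A →ₐ[k] B) : A ⊗[k] Bᵐᵒᵖ →ₐ[k] Module.End k B :=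
  Algebra.TensorProduct.lift ((Algebra.lmul k B).comp f) (Algebra.lsmul k k B)
    fun x y => by ext b; simp [mul_assoc]

/-- `B` regarded as an `(A, B)`-bimodule, with `A` acting on the left through `f`. -/
def AlgHom.Bimodule (_f : A →ₐ[k] B) : Type _ := B

instance (f : A →ₐ[k] B) : AddCommGroup f.Bimodule := inferInstanceAs (AddCommGroup B)

noncomputable instance (f : A →ₐ[k] B) : Module (A ⊗[k] Bᵐᵒᵖ) f.Bimodule :=
  Module.compHom B f.bimoduleAction.toRingHom

theorem AlgHom.Bimodule.tmul_smul (f : A →ₐ[k] B) (x : A) (y b : B) :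
    (x ⊗ₜ[k] MulOpposite.op y • (show f.Bimodule from b) : f.Bimodule) = f x * (b * y) := by
  change f.bimoduleAction (x ⊗ₜ[k] MulOpposite.op y) b = f x * (b * y)
  have h : f.bimoduleAction (x ⊗ₜ[k] MulOpposite.op y) =
      Algebra.lmul k B (f x) * Algebra.lsmul k k B (MulOpposite.op y) :=
    Algebra.TensorProduct.lift_tmul ..
  rw [h]
  simp

theorem AlgHom.Bimodule.length_le (f : A →ₐ[k] B) :
    Module.length (A ⊗[k] Bᵐᵒᵖ) f.Bimodule ≤ Module.length (A ⊗[k] Bᵐᵒᵖ) (A ⊗[k] Bᵐᵒᵖ) := by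
  refine Module.length_le_of_surjective
    (LinearMap.toSpanSingleton _ _ (show f.Bimodule from (1 : B))) fun (b : B) => ?_
  refine ⟨1 ⊗ₜ MulOpposite.op b, ?_⟩
  rw [LinearMap.toSpanSingleton_apply]
  refine (AlgHom.Bimodule.tmul_smul f 1 b 1).trans ?_
  rw [map_one, one_mul, one_mul]

theorem AlgHom.Bimodule.exists_conj_of_linearEquiv {f g : A →ₐ[k] B}
    (e : g.Bimodule ≃ₗ[A ⊗[k] Bᵐᵒᵖ] f.Bimodule) :
    ∃ u : Bˣ, ∀ x, f x = u * g x * ↑u⁻¹ := by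
  let φ : B → B := e
  let ψ : B → B := e.symm
  have hφ (x : A) (y b : B) : φ (g x * (b * y)) = f x * (φ b * y) := by
    have := e.map_smul (x ⊗ₜ MulOpposite.op y) b
    exact ((congrArg φ (tmul_smul g x y b)).symm.trans this).trans (tmul_smul f x y (φ b))
  have hψ (x : A) (y b : B) : ψ (f x * (b * y)) = g x * (ψ b * y) := by
    have := e.symm.map_smul (x ⊗ₜ MulOpposite.op y) b
    exact ((congrArg ψ (tmul_smul f x y b)).symm.trans this).trans (tmul_smul g x y (ψ b))
  have φ_eq (b : B) : φ b = φ 1 * b := by simpa using hφ 1 b 1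
  have ψ_eq (b : B) : ψ b = ψ 1 * b := by simpa using hψ 1 b 1
  have h₁ : φ 1 * ψ 1 = 1 := (φ_eq _).symm.trans (e.apply_symm_apply _)
  have h₂ : ψ 1 * φ 1 = 1 := (ψ_eq _).symm.trans (e.symm_apply_apply _)
  refine ⟨⟨φ 1, ψ 1, h₁, h₂⟩, fun x => ?_⟩
  have := hφ x 1 1
  rw [mul_one, mul_one, mul_one, φ_eq] at this
  change f x = φ 1 * g x * ψ 1
  rw [this, mul_assoc, h₁, mul_one]

end Bimodule

/-- Over a real closed field `k`, for every finite-dimensional division algebra `A` over `k`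
and every finite-dimensional simple `k`-algebra `B`, there are only finitely many `k`-algebra
homomorphisms `A → B` up to conjugation by invertible elements of `B`. -/
theorem stmt_10 (k : Type) [Field k] (hk : IsRealClosedField k)
    (A : Type) [DivisionRing A] [Algebra k A] [FiniteDimensional k A]
    (B : Type) [Ring B] [Algebra k B] [FiniteDimensional k B] [IsSimpleRing B] :
    ∃ (n : ℕ) (reps : Fin n → (A →ₐ[k] B)),
      ∀ f : A →ₐ[k] B, ∃ (t : Fin n) (u : Bˣ), ∀ x : A, f x = u * reps t x * ↑u⁻¹ := by
  have := hk.1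
  have : IsArtinianRing B := IsArtinianRing.of_finite k B
  have := isSemisimpleRing_tensorProduct k A Bᵐᵒᵖ
  have hlen : Module.length (A ⊗[k] Bᵐᵒᵖ) (A ⊗[k] Bᵐᵒᵖ) ≠ ⊤ := Module.length_ne_top
  obtain ⟨N, hN⟩ := ENat.ne_top_iff_exists.mp hlen
  obtain ⟨ι, _, c, hc⟩ := IsSemisimpleRing.exists_classifier_of_length_le (A ⊗[k] Bᵐᵒᵖ) N
    (fun f : A →ₐ[k] B => f.Bimodule) fun f => hN ▸ AlgHom.Bimodule.length_le f
  let E := Finite.equivFin (Set.range c)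
  refine ⟨_, fun t => (E.symm t).2.choose, fun f => ⟨E ⟨c f, f, rfl⟩, ?_⟩⟩
  refine AlgHom.Bimodule.exists_conj_of_linearEquiv (hc _ _ ?_).some
  rw [(E.symm (E ⟨c f, f, rfl⟩)).2.choose_spec, E.symm_apply_apply]
end
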